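/- arXiv:1606.06229 — 2 statements merged into one kernel-verified Lean document; each statement's English description precedes it below -/
import Mathlib

section
/- (Third-order identity in the proof of Theorem 3.) Let d₀, c₀, c₁, b₀, b₁, b₂ ∈ ℝ and let φ : ℝ → ℂ be a Schwartz function satisfying φ'''(x) = d₀·φ''(x) + (c₀ + c₁x)·φ'(x) + (b₀ + b₁x + b₂x²)·φ(x) for all x ∈ ℝ. Let φ̄ be its Fourier transform and set ν(t,x) := (1/(2π)) ∫_ℝ φ̄(λ) e^{iλx − λ²t/2} dλ. Then for all t > 0 and x ∈ ℝ: ∂³_x ν = (d₀ + c₁t + b₂t²)·∂²_x ν + (c₀ + c₁x + b₁t + 2b₂tx)·∂_x ν + (b₀ + b₁x + b₂x² + b₂t)·ν, where all derivatives are evaluated at (t,x). -/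
open MeasureTheory

/-- The Fourier transform `φ̄(λ) = ∫_ℝ φ(x) e^{−iλx} dx` of an integrable `φ : ℝ → ℂ`. -/
noncomputable def fourierT (φ : ℝ → ℂ) (l : ℝ) : ℂ :=
  ∫ x : ℝ, φ x * Complex.exp (-(Complex.I * (l : ℂ) * (x : ℂ)))

/-- `ν(t,x) := (1/(2π)) ∫_ℝ φ̄(λ) e^{iλx − λ²t/2} dλ`. -/
noncomputable def nu (φb : ℝ → ℂ) (t x : ℝ) : ℂ :=
  (1 / (2 * (Real.pi : ℂ))) *
    ∫ l : ℝ, φb l * Complex.exp (Complex.I * (l : ℂ) * (x : ℂ) - (l : ℂ) ^ 2 * (t : ℂ) / 2)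

open scoped FourierTransform SchwartzMap

/-- The kernel `exp(2πiξx - 2π²ξ²t)`. -/
noncomputable def kerE (t x l : ℝ) : ℂ :=
  Complex.exp (2 * Real.pi * Complex.I * l * x - 2 * Real.pi ^ 2 * l ^ 2 * t)

/-- Heat semigroup in frequency variables. -/
noncomputable def heatQ (f : 𝓢(ℝ, ℂ)) (t x : ℝ) : ℂ :=
  ∫ l : ℝ, (𝓕 f) l * kerE t x l

/-- Multiplication by `x`. -/
noncomputable def mulX (f : 𝓢(ℝ, ℂ)) : 𝓢(ℝ, ℂ) :=
  SchwartzMap.smulLeftCLM ℂ (fun x : ℝ => (x : ℂ)) f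

lemma mulX_apply (f : 𝓢(ℝ, ℂ)) (x : ℝ) : mulX f x = x * f x := by
  unfold mulX
  rw [SchwartzMap.smulLeftCLM_apply_apply (by fun_prop), smul_eq_mul]

/-- Derivative. -/
noncomputable def dX (f : 𝓢(ℝ, ℂ)) : 𝓢(ℝ, ℂ) := SchwartzMap.derivCLM ℂ ℂ f

lemma dX_coe (f : 𝓢(ℝ, ℂ)) : ⇑(dX f) = deriv f := rfl

lemma nu_eq (f : 𝓢(ℝ, ℂ)) (t x : ℝ) : nu (fourierT f) t x = heatQ f t x := by
  have hp : (Real.pi : ℂ) ≠ 0 := by exact_mod_cast Real.pi_ne_zero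
  have h := Measure.integral_comp_mul_left (fun l : ℝ => fourierT f l *
    Complex.exp (Complex.I * (l : ℂ) * (x : ℂ) - (l : ℂ) ^ 2 * (t : ℂ) / 2)) (2 * Real.pi)
  unfold nu heatQ
  have h2 : (1 / (2 * (Real.pi : ℂ))) = ((|(2 * Real.pi)⁻¹| : ℝ) : ℂ) := by
    rw [abs_of_pos (by positivity)]
    push_cast
    rw [one_div]
  rw [h2, ← Complex.real_smul, ← h]
  congr 1
  ext l
  congr 1
  · unfold fourierT
    rw [SchwartzMap.fourier_coe, Real.fourier_real_eq_integral_exp_smul]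
    congr 1
    ext v
    rw [smul_eq_mul, mul_comm]
    congr 2
    push_cast
    ring
  · unfold kerE
    congr 1
    push_cast
    ring

lemma norm_kerE (t x l : ℝ) (ht : 0 < t) : ‖kerE t x l‖ ≤ 1 := by
  unfold kerE
  have h : (2 * Real.pi * Complex.I * l * x - 2 * Real.pi ^ 2 * l ^ 2 * t : ℂ)
    = ((-(2 * Real.pi ^ 2 * l ^ 2 * t) : ℝ) : ℂ) + ((2 * Real.pi * l * x : ℝ) : ℂ) * Complex.I := by
    push_cast
    ring
  rw [h, Complex.norm_exp, Real.exp_le_one_iff]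
  have : 0 ≤ 2 * Real.pi ^ 2 * l ^ 2 * t := by positivity
  simpa [-Complex.ofReal_mul, -Complex.ofReal_neg, -Complex.ofReal_pow] using this

lemma continuous_kerE (t x : ℝ) : Continuous (kerE t x) := by
  unfold kerE
  fun_prop

lemma integrable_mul_kerE (t x : ℝ) (ht : 0 < t) (g : 𝓢(ℝ, ℂ)) :
    Integrable (fun l => g l * kerE t x l) := by
  refine (g.integrable (μ := volume)).mono
    (g.continuous.mul (continuous_kerE t x)).aestronglyMeasurable (.of_forall fun l => ?_)
  rw [norm_mul]
  exact mul_le_of_le_one_right (norm_nonneg _) (norm_kerE t x l ht)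

lemma hasDerivAt_kerE_x (t x l : ℝ) :
    HasDerivAt (fun y => kerE t y l) (2 * Real.pi * Complex.I * l * kerE t x l) x := by
  unfold kerE
  have h := ((((hasDerivAt_id (x : ℂ)).const_mul (2 * Real.pi * Complex.I * l : ℂ)).sub_const
    (2 * Real.pi ^ 2 * l ^ 2 * t : ℂ)).cexp).comp_ofReal
  convert! h using 1
  simp
  ring

lemma hasDerivAt_kerE_l (t x l : ℝ) :
    HasDerivAt (fun y => kerE t x y)
      ((2 * Real.pi * Complex.I * x - 4 * Real.pi ^ 2 * l * t) * kerE t x l) l := by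
  unfold kerE
  have h := ((((hasDerivAt_id (l : ℂ)).const_mul (2 * Real.pi * Complex.I : ℂ)).mul_const (x : ℂ)).sub
    ((((hasDerivAt_id (l : ℂ)).pow 2).const_mul (2 * Real.pi ^ 2 : ℂ)).mul_const (t : ℂ))).cexp.comp_ofReal
  convert! h using 1
  simp
  ring

lemma fourier_dX (f : 𝓢(ℝ, ℂ)) (l : ℝ) :
    (𝓕 (dX f)) l = 2 * Real.pi * Complex.I * l * (𝓕 f) l := by
  have h := Real.fourier_deriv (f.integrable (μ := volume)) f.differentiable
    ((dX f).integrable (μ := volume))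
  rw [SchwartzMap.fourier_coe, SchwartzMap.fourier_coe, dX_coe, h]
  rfl

lemma hasDerivAt_fourier_mulX (f : 𝓢(ℝ, ℂ)) (l : ℝ) :
    HasDerivAt (⇑(𝓕 f : 𝓢(ℝ, ℂ))) (-2 * Real.pi * Complex.I * (𝓕 (mulX f)) l) l := by
  have hi := (mulX f).integrable (μ := volume)
  have h := Real.hasDerivAt_fourier (f.integrable (μ := volume))
    (by simpa [funext (mulX_apply f)] using hi) l
  rw [← SchwartzMap.fourier_coe] at h
  convert! h using 1
  rw [SchwartzMap.fourier_coe, Real.fourier_real_eq, Real.fourier_real_eq, ← integral_const_mul]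
  congr 1
  ext v
  simp only [mulX_apply, Circle.smul_def, smul_eq_mul]
  ring

lemma hasDerivAt_heatQ (f : 𝓢(ℝ, ℂ)) (t x : ℝ) (ht : 0 < t) :
    HasDerivAt (heatQ f t) (heatQ (dX f) t x) x := by
  have h := (hasDerivAt_integral_of_dominated_loc_of_deriv_le (μ := volume) (s := Set.univ)
    (F := fun y l => (𝓕 f) l * kerE t y l) (F' := fun y l => (𝓕 (dX f)) l * kerE t y l)
    (bound := fun l => ‖(𝓕 (dX f)) l‖) (x₀ := x) Filter.univ_mem
    (.of_forall fun y => (integrable_mul_kerE t y ht _).aestronglyMeasurable)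
    (integrable_mul_kerE t x ht _) (integrable_mul_kerE t x ht _).aestronglyMeasurable
    (.of_forall fun l y _ => ?_) ((𝓕 (dX f)).integrable.norm)
    (.of_forall fun l y _ => ?_)).2
  · exact h
  · rw [norm_mul]
    exact mul_le_of_le_one_right (norm_nonneg _) (norm_kerE t y l ht)
  · convert! (hasDerivAt_kerE_x t y l).const_mul ((𝓕 f) l) using 1
    rw [fourier_dX]
    ring

lemma heatQ_mulX (f : 𝓢(ℝ, ℂ)) (t x : ℝ) (ht : 0 < t) :
    heatQ (mulX f) t x = x * heatQ f t x + t * heatQ (dX f) t x := by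
  have hp : (Real.pi : ℂ) ≠ 0 := by exact_mod_cast Real.pi_ne_zero
  have i1 := integrable_mul_kerE t x ht (𝓕 f)
  have i2 := integrable_mul_kerE t x ht (𝓕 (dX f))
  have i3 := integrable_mul_kerE t x ht (𝓕 (mulX f))
  have e : ∀ l : ℝ, (𝓕 f) l * ((2 * Real.pi * Complex.I * x - 4 * Real.pi ^ 2 * l * t) * kerE t x l)
      = (2 * Real.pi * Complex.I * x) * ((𝓕 f) l * kerE t x l)
        + (2 * Real.pi * Complex.I * t) * ((𝓕 (dX f)) l * kerE t x l) := by
    intro l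
    rw [fourier_dX]
    linear_combination (-4 * Real.pi ^ 2 * l * t * (𝓕 f) l * kerE t x l) * Complex.I_sq
  have e' : ∀ l : ℝ, (-2 * Real.pi * Complex.I * (𝓕 (mulX f)) l) * kerE t x l
      = (-2 * Real.pi * Complex.I) * ((𝓕 (mulX f)) l * kerE t x l) := fun l => by ring
  have h := integral_mul_deriv_eq_deriv_mul_of_integrable (u := ⇑(𝓕 f : 𝓢(ℝ, ℂ))) (v := kerE t x)
    (fun l _ => hasDerivAt_fourier_mulX f l) (fun l _ => hasDerivAt_kerE_l t x l)
    (by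
      refine ((i1.const_mul (2 * Real.pi * Complex.I * x)).add
        (i2.const_mul (2 * Real.pi * Complex.I * t))).congr (.of_forall fun l => ?_)
      exact (e l).symm)
    (by
      refine (i3.const_mul (-2 * Real.pi * Complex.I)).congr (.of_forall fun l => ?_)
      exact (e' l).symm) i1
  simp only [e, e'] at h
  rw [integral_add (i1.const_mul _) (i2.const_mul _)] at h
  simp only [integral_const_mul] at h
  change _ * heatQ f t x + _ * heatQ (dX f) t x = -(_ * heatQ (mulX f) t x) at h
  have h0 : (2 * Real.pi * Complex.I : ℂ) ≠ 0 := by simp [hp]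
  apply mul_left_cancel₀ h0
  linear_combination -h

lemma heatQ_add (f g : 𝓢(ℝ, ℂ)) (t x : ℝ) (ht : 0 < t) :
    heatQ (f + g) t x = heatQ f t x + heatQ g t x := by
  unfold heatQ
  rw [← integral_add (integrable_mul_kerE t x ht _) (integrable_mul_kerE t x ht _)]
  congr 1
  ext l
  rw [FourierTransform.fourier_add, add_apply]
  ring

lemma heatQ_smul (c : ℂ) (f : 𝓢(ℝ, ℂ)) (t x : ℝ) :
    heatQ (c • f) t x = c * heatQ f t x := by
  unfold heatQ
  rw [← integral_const_mul]
  congr 1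
  ext l
  rw [FourierTransform.fourier_smul, smul_apply, smul_eq_mul]
  ring

lemma dX_mulX (f : 𝓢(ℝ, ℂ)) : dX (mulX f) = f + mulX (dX f) := by
  ext x
  have h : HasDerivAt (mulX f) (1 * f x + x * deriv f x) x := by
    rw [funext (mulX_apply f)]
    exact ((hasDerivAt_id (x : ℂ)).comp_ofReal).mul (f.hasDerivAt x)
  rw [dX_coe, h.deriv, add_apply, mulX_apply, dX_coe, one_mul]

/-- Third-order identity in the proof of Theorem 3: if the Schwartz function `φ` satisfies
`φ''' = d₀·φ'' + (c₀ + c₁x)·φ' + (b₀ + b₁x + b₂x²)·φ`, then for all `t > 0`, `x ∈ ℝ`: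
`∂³_x ν = (d₀ + c₁t + b₂t²)·∂²_x ν + (c₀ + c₁x + b₁t + 2b₂tx)·∂_x ν
        + (b₀ + b₁x + b₂x² + b₂t)·ν`. -/
theorem third_order_identity (d0 c0 c1 b0 b1 b2 : ℝ) (φ : SchwartzMap ℝ ℂ)
    (hODE : ∀ x : ℝ, deriv (deriv (deriv (⇑φ))) x
      = (d0 : ℂ) * deriv (deriv (⇑φ)) x + ((c0 + c1 * x : ℝ) : ℂ) * deriv (⇑φ) x
        + ((b0 + b1 * x + b2 * x ^ 2 : ℝ) : ℂ) * φ x) :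
    ∀ t : ℝ, 0 < t → ∀ x : ℝ,
      iteratedDeriv 3 (fun y : ℝ => nu (fourierT (⇑φ)) t y) x
        = ((d0 + c1 * t + b2 * t ^ 2 : ℝ) : ℂ) *
            iteratedDeriv 2 (fun y : ℝ => nu (fourierT (⇑φ)) t y) x
          + ((c0 + c1 * x + b1 * t + 2 * b2 * t * x : ℝ) : ℂ) *
            deriv (fun y : ℝ => nu (fourierT (⇑φ)) t y) x
          + ((b0 + b1 * x + b2 * x ^ 2 + b2 * t : ℝ) : ℂ) * nu (fourierT (⇑φ)) t x := by
  intro t ht x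
  have D : ∀ f : 𝓢(ℝ, ℂ), deriv (heatQ f t) = heatQ (dX f) t :=
    fun f => funext fun y => (hasDerivAt_heatQ f t y ht).deriv
  have hn : (fun y : ℝ => nu (fourierT (⇑φ)) t y) = heatQ φ t := funext fun y => nu_eq φ t y
  have hS : dX (dX (dX φ)) = (d0 : ℂ) • dX (dX φ) + ((c0 : ℂ) • dX φ + ((c1 : ℂ) • mulX (dX φ)
      + ((b0 : ℂ) • φ + ((b1 : ℂ) • mulX φ + (b2 : ℂ) • mulX (mulX φ))))) := by
    ext y
    simp only [add_apply, smul_apply, mulX_apply, dX_coe, smul_eq_mul]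
    rw [hODE y]
    push_cast
    ring
  rw [nu_eq, hn, iteratedDeriv_succ, iteratedDeriv_succ, iteratedDeriv_one, D, D, D, hS]
  simp only [heatQ_add _ _ t x ht, heatQ_smul, heatQ_mulX _ t x ht, dX_mulX]
  push_cast
  ring
end

section
/- (Specialized boundary equation in the proof of Theorem 3.) Let b₂ ∈ ℝ and U = (0,∞) × ℝ. Suppose ν : ℝ × ℝ → ℝ is smooth (C^∞) on U, satisfies the heat equation ∂_t ν = (1/2)·∂²_{xx} ν on U, and satisfies ∂³_x ν = b₂t²·∂²_x ν + 2b₂tx·∂_x ν + (b₂x² + b₂t)·ν for all (t,x) ∈ U. Let f : (0,∞) → ℝ be twice differentiable with ν(t, f(t)) = 0 and ∂_x ν(t, f(t)) ≠ 0 for all t > 0. Then for all t > 0: −4f''(t) + 2f'(t)·[4(f'(t))² + 4b₂t²f'(t) − 2b₂t·f(t) + b₂²t⁴] − b₂·f(t)·[2b₂t³ + f(t)] − 3b₂t = 0. -/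
open Set Filter Topology

/-- The open domain `(0,∞) × ℝ`. -/
def UU : Set (ℝ × ℝ) := Set.Ioi (0 : ℝ) ×ˢ Set.univ

/-- Spatial partial derivative. -/
noncomputable def DX (G : ℝ × ℝ → ℝ) : ℝ × ℝ → ℝ := fun p => fderiv ℝ G p (0, 1)

/-- Time partial derivative. -/
noncomputable def DT (G : ℝ × ℝ → ℝ) : ℝ × ℝ → ℝ := fun p => fderiv ℝ G p (1, 0)

lemma UU_open : IsOpen UU := isOpen_Ioi.prod isOpen_univ

lemma mem_UU {t : ℝ} (ht : 0 < t) (x : ℝ) : (t, x) ∈ UU := ⟨ht, trivial⟩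

lemma fd_smooth {G : ℝ × ℝ → ℝ} (hG : ContDiffOn ℝ (⊤ : ℕ∞) G UU) :
    ContDiffOn ℝ (⊤ : ℕ∞) (fderiv ℝ G) UU :=
  hG.fderiv_of_isOpen UU_open (by simp)

lemma DX_smooth {G : ℝ × ℝ → ℝ} (hG : ContDiffOn ℝ (⊤ : ℕ∞) G UU) :
    ContDiffOn ℝ (⊤ : ℕ∞) (DX G) UU :=
  (fd_smooth hG).clm_apply contDiffOn_const

lemma hasFD {G : ℝ × ℝ → ℝ} (hG : ContDiffOn ℝ (⊤ : ℕ∞) G UU) {t : ℝ} (ht : 0 < t) (x : ℝ) :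
    HasFDerivAt G (fderiv ℝ G (t, x)) (t, x) :=
  ((hG.contDiffAt (UU_open.mem_nhds (mem_UU ht x))).differentiableAt (by simp)).hasFDerivAt

lemma chain {G : ℝ × ℝ → ℝ} (hG : ContDiffOn ℝ (⊤ : ℕ∞) G UU) {t : ℝ} (ht : 0 < t)
    {f : ℝ → ℝ} {f' : ℝ} (hf : HasDerivAt f f' t) :
    HasDerivAt (fun s => G (s, f s)) (DT G (t, f t) + f' * DX G (t, f t)) t := by
  have h := (hasFD hG ht (f t)).comp_hasDerivAt t ((hasDerivAt_id t).prodMk hf)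
  have e : ((1 : ℝ), f') = (1, 0) + f' • ((0 : ℝ), (1 : ℝ)) := by simp
  rw [e, map_add, map_smul] at h
  exact h

lemma slice_x {G : ℝ × ℝ → ℝ} (hG : ContDiffOn ℝ (⊤ : ℕ∞) G UU) {t : ℝ} (ht : 0 < t) (x : ℝ) :
    HasDerivAt (fun y => G (t, y)) (DX G (t, x)) x :=
  (hasFD hG ht x).comp_hasDerivAt x ((hasDerivAt_const x t).prodMk (hasDerivAt_id x))

lemma slice_t {G : ℝ × ℝ → ℝ} (hG : ContDiffOn ℝ (⊤ : ℕ∞) G UU) {t : ℝ} (ht : 0 < t) (x : ℝ) :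
    HasDerivAt (fun s => G (s, x)) (DT G (t, x)) t :=
  (hasFD hG ht x).comp_hasDerivAt t ((hasDerivAt_id t).prodMk (hasDerivAt_const t x))

lemma DT_smooth {G : ℝ × ℝ → ℝ} (hG : ContDiffOn ℝ (⊤ : ℕ∞) G UU) :
    ContDiffOn ℝ (⊤ : ℕ∞) (DT G) UU :=
  (fd_smooth hG).clm_apply contDiffOn_const

lemma DT_DX_comm {G : ℝ × ℝ → ℝ} (hG : ContDiffOn ℝ (⊤ : ℕ∞) G UU) {t : ℝ} (ht : 0 < t) (x : ℝ) :
    DT (DX G) (t, x) = DX (DT G) (t, x) := by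
  have hU := UU_open.mem_nhds (mem_UU ht x)
  have hs : IsSymmSndFDerivAt ℝ G (t, x) :=
    (hG.contDiffAt hU).isSymmSndFDerivAt (by simp only [minSmoothness_of_isRCLikeNormedField]; exact WithTop.coe_le_coe.2 (le_top : (2 : ℕ∞) ≤ ⊤))
  have hd : HasFDerivAt (fderiv ℝ G) (fderiv ℝ (fderiv ℝ G) (t, x)) (t, x) :=
    (((fd_smooth hG).contDiffAt hU).differentiableAt (by simp)).hasFDerivAt
  have h1 : ∀ v w, fderiv ℝ (fun p => fderiv ℝ G p v) (t, x) w
      = fderiv ℝ (fderiv ℝ G) (t, x) w v := by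
    intro v w
    have := (hd.clm_apply (hasFDerivAt_const v (t, x))).fderiv
    rw [this]
    simp
  unfold DT DX
  rw [h1, h1]
  exact hs _ _

lemma heat_step {G : ℝ × ℝ → ℝ} (hG : ContDiffOn ℝ (⊤ : ℕ∞) G UU)
    (h : ∀ t : ℝ, 0 < t → ∀ x : ℝ, DT G (t, x) = (1 / 2) * DX (DX G) (t, x)) :
    ∀ t : ℝ, 0 < t → ∀ x : ℝ, DT (DX G) (t, x) = (1 / 2) * DX (DX (DX G)) (t, x) := by
  intro t ht x
  rw [DT_DX_comm hG ht x]
  have h1 := slice_x (DT_smooth hG) ht x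
  have h2 := (slice_x (DX_smooth (DX_smooth hG)) ht x).const_mul (1 / 2)
  have e : (fun y => DT G (t, y)) = fun y => (1 / 2) * DX (DX G) (t, y) := by
    funext y; exact h t ht y
  rw [e] at h1
  exact h1.unique h2

/-- Specialized boundary equation in the proof of Theorem 3: if `ν` is `C^∞` on
`U = (0,∞) × ℝ`, solves the heat equation on `U`, satisfies
`∂³_x ν = b₂t²·∂²_x ν + 2b₂tx·∂_x ν + (b₂x² + b₂t)·ν` on `U`, and vanishes along a twice
differentiable boundary `f` with `∂_x ν(t,f(t)) ≠ 0`, then for all `t > 0`: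
`−4f'' + 2f'·[4(f')² + 4b₂t²f' − 2b₂t·f + b₂²t⁴] − b₂·f·[2b₂t³ + f] − 3b₂t = 0`. -/
theorem specialized_boundary_equation (b2 : ℝ) (ν : ℝ → ℝ → ℝ) (f : ℝ → ℝ)
    (hν : ContDiffOn ℝ (⊤ : ℕ∞) (fun p : ℝ × ℝ => ν p.1 p.2) (Set.Ioi (0 : ℝ) ×ˢ Set.univ))
    (hheat : ∀ t : ℝ, 0 < t → ∀ x : ℝ,
      deriv (fun s : ℝ => ν s x) t = (1 / 2) * iteratedDeriv 2 (fun y : ℝ => ν t y) x)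
    (hid : ∀ t : ℝ, 0 < t → ∀ x : ℝ,
      iteratedDeriv 3 (fun y : ℝ => ν t y) x
        = b2 * t ^ 2 * iteratedDeriv 2 (fun y : ℝ => ν t y) x
          + 2 * b2 * t * x * deriv (fun y : ℝ => ν t y) x
          + (b2 * x ^ 2 + b2 * t) * ν t x)
    (hf : ∀ t : ℝ, 0 < t → DifferentiableAt ℝ f t)
    (hf' : ∀ t : ℝ, 0 < t → DifferentiableAt ℝ (deriv f) t)
    (hzero : ∀ t : ℝ, 0 < t → ν t (f t) = 0)
    (hne : ∀ t : ℝ, 0 < t → deriv (fun y : ℝ => ν t y) (f t) ≠ 0) :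
    ∀ t : ℝ, 0 < t →
      -4 * deriv (deriv f) t
          + 2 * deriv f t *
            (4 * (deriv f t) ^ 2 + 4 * b2 * t ^ 2 * deriv f t - 2 * b2 * t * f t
              + b2 ^ 2 * t ^ 4)
          - b2 * f t * (2 * b2 * t ^ 3 + f t) - 3 * b2 * t = 0 := by
  intro t ht
  let G : ℝ × ℝ → ℝ := fun p => ν p.1 p.2
  have G0 : ContDiffOn ℝ (⊤ : ℕ∞) G UU := hν
  have G1 := DX_smooth G0
  have G2 := DX_smooth G1
  have G3 := DX_smooth G2
  have d1 : ∀ t : ℝ, 0 < t → deriv (fun y => ν t y) = fun x => DX G (t, x) := by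
    intro t ht; funext x; exact (slice_x G0 ht x).deriv
  have d2 : ∀ t : ℝ, 0 < t → iteratedDeriv 2 (fun y => ν t y) = fun x => DX (DX G) (t, x) := by
    intro t ht
    rw [iteratedDeriv_succ, iteratedDeriv_one, d1 t ht]
    funext x; exact (slice_x G1 ht x).deriv
  have d3 : ∀ t : ℝ, 0 < t →
      iteratedDeriv 3 (fun y => ν t y) = fun x => DX (DX (DX G)) (t, x) := by
    intro t ht
    rw [iteratedDeriv_succ, d2 t ht]
    funext x; exact (slice_x G2 ht x).deriv
  have e0 : ∀ t : ℝ, 0 < t → ∀ x : ℝ, DT G (t, x) = (1 / 2) * DX (DX G) (t, x) := by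
    intro t ht x
    have := hheat t ht x
    rw [d2 t ht] at this
    rw [← this]
    exact (slice_t G0 ht x).deriv.symm
  have e1 := heat_step G0 e0
  have e2 := heat_step G1 e1
  have i3 : ∀ t : ℝ, 0 < t → ∀ x : ℝ, DX (DX (DX G)) (t, x)
      = b2 * t ^ 2 * DX (DX G) (t, x) + 2 * b2 * t * x * DX G (t, x)
        + (b2 * x ^ 2 + b2 * t) * G (t, x) := by
    intro t ht x
    have := hid t ht x
    rw [d3 t ht, d2 t ht, d1 t ht] at this
    exact this
  have i4 : ∀ x : ℝ, DX (DX (DX (DX G))) (t, x)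
      = b2 * t ^ 2 * DX (DX (DX G)) (t, x)
        + (2 * b2 * t * DX G (t, x) + 2 * b2 * t * x * DX (DX G) (t, x))
        + (b2 * (2 * x) * G (t, x) + (b2 * x ^ 2 + b2 * t) * DX G (t, x)) := by
    intro x
    have h1 := slice_x G3 ht x
    have e : (fun y => DX (DX (DX G)) (t, y)) = fun y =>
        b2 * t ^ 2 * DX (DX G) (t, y) + 2 * b2 * t * y * DX G (t, y)
        + (b2 * y ^ 2 + b2 * t) * G (t, y) := by
      funext y; exact i3 t ht y
    rw [e] at h1
    have hA := (slice_x G2 ht x).const_mul (b2 * t ^ 2)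
    have hB := ((hasDerivAt_id x).const_mul (2 * b2 * t)).mul (slice_x G1 ht x)
    have hC := ((((hasDerivAt_id x).pow 2).const_mul b2).add_const (b2 * t)).mul (slice_x G0 ht x)
    have := h1.unique ((hA.add hB).add hC)
    rw [this]
    simp
  have z : ∀ s : ℝ, 0 < s → G (s, f s) = 0 := hzero
  have q : ∀ s : ℝ, 0 < s → DX (DX G) (s, f s) + 2 * deriv f s * DX G (s, f s) = 0 := by
    intro s hs
    have h1 := chain G0 hs (hf s hs).hasDerivAt
    have h2 : HasDerivAt (fun s => G (s, f s)) 0 s :=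
      (hasDerivAt_const s (0 : ℝ)).congr_of_eventuallyEq
        (by filter_upwards [Ioi_mem_nhds hs] with r hr using z r hr)
    have h3 := h1.unique h2
    rw [e0 s hs] at h3
    linarith
  have h1 := (chain G2 ht (hf t ht).hasDerivAt).add
    (((hf' t ht).hasDerivAt.const_mul 2).mul (chain G1 ht (hf t ht).hasDerivAt))
  have h2 : HasDerivAt (fun s => DX (DX G) (s, f s) + 2 * deriv f s * DX G (s, f s)) 0 t :=
    (hasDerivAt_const t (0 : ℝ)).congr_of_eventuallyEq
      (by filter_upwards [Ioi_mem_nhds ht] with r hr using q r hr)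
  have h3 := h1.unique h2
  have hp : DX G (t, f t) ≠ 0 := by
    have := hne t ht
    rwa [d1 t ht] at this
  have hq := q t ht
  have hq' : DX (DX G) (t, f t) = - (2 * deriv f t * DX G (t, f t)) := by linarith
  rw [e2 t ht, e1 t ht, i4, i3 t ht, z t ht, hq'] at h3
  apply mul_left_cancel₀ hp
  linear_combination (-2) * h3
end
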